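/- The iterated Lie bracket h2 := [f3, [f0, [f0, [f0, f3]]]], evaluated at the equilibrium x_e = (−ω0, 0, 0, 0, 0, 0), equals ( 0, 0, 0, −ω0·β²·(I1² − (2I2 + I3)·I1 + I2·(I2 + 2I3))/(I1·I2²·I3), 0, 0 ), i.e. a scalar multiple of the fourth standard basis vector of ℝ^6. -/

import Mathlib

/- State x = (ω1, ω2, ω3, q1, q2, q3) : indices 0..5.  q4 = √(1 − q1² − q2² − q3²). -/
noncomputable def q4 (x : Fin 6 → ℝ) : ℝ := Real.sqrt (1 - x 3 ^ 2 - x 4 ^ 2 - x 5 ^ 2)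

/-- Drift vector field of the satellite system. -/
noncomputable def f0 (I1 I2 I3 om : ℝ) (x : Fin 6 → ℝ) : Fin 6 → ℝ :=
  ![(I2 - I3) / I1 * (x 1 * x 2)
      + 6 * om ^ 2 * (I2 - I3) / I1 * ((x 3 * q4 x + x 4 * x 5) * (2 * x 3 ^ 2 + 2 * x 4 ^ 2 - 1)),
    (I3 - I1) / I2 * (x 0 * x 2)
      + 6 * om ^ 2 * (I3 - I1) / I2 * ((x 3 * x 5 - x 4 * q4 x) * (2 * x 3 ^ 2 + 2 * x 4 ^ 2 - 1)),
    (I1 - I2) / I3 * (x 0 * x 1)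
      + 12 * om ^ 2 * (I1 - I2) / I3 * ((x 3 * q4 x + x 4 * x 5) * (x 4 * q4 x - x 3 * x 5)),
    (1 / 2) * ((x 0 + om) * q4 x - x 1 * x 5 + x 2 * x 4),
    (1 / 2) * ((x 0 - om) * x 5 + x 1 * q4 x - x 2 * x 3),
    (1 / 2) * (-(x 0 - om) * x 4 + x 1 * x 3 + x 2 * q4 x)]

/-- Controlled vector field f1. -/
noncomputable def f1 (I2 I3 b : ℝ) (x : Fin 6 → ℝ) : Fin 6 → ℝ :=
  ![0, -2 * b * (x 3 * x 5 + x 4 * q4 x) / I2, 2 * b * (x 3 * x 4 - x 5 * q4 x) / I3, 0, 0, 0]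

/-- Controlled vector field f2. -/
noncomputable def f2 (I1 I3 b : ℝ) (x : Fin 6 → ℝ) : Fin 6 → ℝ :=
  ![2 * b * (x 3 * x 5 + x 4 * q4 x) / I1, 0, b * (2 * x 4 ^ 2 + 2 * x 5 ^ 2 - 1) / I3, 0, 0, 0]

/-- Controlled vector field f3. -/
noncomputable def f3 (I1 I2 b : ℝ) (x : Fin 6 → ℝ) : Fin 6 → ℝ :=
  ![2 * b * (x 5 * q4 x - x 3 * x 4) / I1, b * (1 - 2 * x 4 ^ 2 - 2 * x 5 ^ 2) / I2, 0, 0, 0, 0]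

/-- Lie bracket of vector fields: [f,g](x) = Dg(x)·f(x) − Df(x)·g(x). -/
noncomputable def lieB (f g : (Fin 6 → ℝ) → (Fin 6 → ℝ)) (x : Fin 6 → ℝ) : Fin 6 → ℝ :=
  fderiv ℝ g x (f x) - fderiv ℝ f x (g x)

/-- The equilibrium point x_e = (−ω0, 0, 0, 0, 0, 0). -/
noncomputable def xe (om : ℝ) : Fin 6 → ℝ := ![-om, 0, 0, 0, 0, 0]

open scoped ContDiff

/-- Directional derivative of `q4` at `x` along `v`. -/
noncomputable def dq4 (x v : Fin 6 → ℝ) : ℝ := -(x 3 * v 3 + x 4 * v 4 + x 5 * v 5) / q4 x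

/-- Directional derivative of the drift field at `x` along `v`. -/
noncomputable def df0 (I1 I2 I3 om : ℝ) (x v : Fin 6 → ℝ) : Fin 6 → ℝ :=
  ![(I2 - I3) / I1 * (v 1 * x 2 + x 1 * v 2)
      + 6 * om ^ 2 * (I2 - I3) / I1
        * ((v 3 * q4 x + x 3 * dq4 x v + (v 4 * x 5 + x 4 * v 5)) * (2 * x 3 ^ 2 + 2 * x 4 ^ 2 - 1)
          + (x 3 * q4 x + x 4 * x 5) * (4 * x 3 * v 3 + 4 * x 4 * v 4)),
    (I3 - I1) / I2 * (v 0 * x 2 + x 0 * v 2)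
      + 6 * om ^ 2 * (I3 - I1) / I2
        * ((v 3 * x 5 + x 3 * v 5 - (v 4 * q4 x + x 4 * dq4 x v)) * (2 * x 3 ^ 2 + 2 * x 4 ^ 2 - 1)
          + (x 3 * x 5 - x 4 * q4 x) * (4 * x 3 * v 3 + 4 * x 4 * v 4)),
    (I1 - I2) / I3 * (v 0 * x 1 + x 0 * v 1)
      + 12 * om ^ 2 * (I1 - I2) / I3
        * ((v 3 * q4 x + x 3 * dq4 x v + (v 4 * x 5 + x 4 * v 5)) * (x 4 * q4 x - x 3 * x 5)
          + (x 3 * q4 x + x 4 * x 5) * (v 4 * q4 x + x 4 * dq4 x v - (v 3 * x 5 + x 3 * v 5))),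
    (1 / 2) * (v 0 * q4 x + (x 0 + om) * dq4 x v - (v 1 * x 5 + x 1 * v 5)
      + (v 2 * x 4 + x 2 * v 4)),
    (1 / 2) * (v 0 * x 5 + (x 0 - om) * v 5 + (v 1 * q4 x + x 1 * dq4 x v)
      - (v 2 * x 3 + x 2 * v 3)),
    (1 / 2) * (-v 0 * x 4 + -(x 0 - om) * v 4 + (v 1 * x 3 + x 1 * v 3)
      + (v 2 * q4 x + x 2 * dq4 x v))]

/-- Second derivative of the drift field at the equilibrium. -/
noncomputable def d2f0 (I1 I2 I3 om : ℝ) (v w : Fin 6 → ℝ) : Fin 6 → ℝ :=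
  ![(I2 - I3) / I1 * (v 1 * w 2 + w 1 * v 2)
      - 6 * om ^ 2 * (I2 - I3) / I1 * (v 4 * w 5 + w 4 * v 5),
    (I3 - I1) / I2 * (v 0 * w 2 + w 0 * v 2)
      - 6 * om ^ 2 * (I3 - I1) / I2 * (v 3 * w 5 + w 3 * v 5),
    (I1 - I2) / I3 * (v 0 * w 1 + w 0 * v 1)
      + 12 * om ^ 2 * (I1 - I2) / I3 * (v 3 * w 4 + w 3 * v 4),
    (1 / 2) * (-(v 1 * w 5 + w 1 * v 5) + (v 2 * w 4 + w 2 * v 4)),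
    (1 / 2) * ((v 0 * w 5 + w 0 * v 5) - (v 2 * w 3 + w 2 * v 3)),
    (1 / 2) * (-(v 0 * w 4 + w 0 * v 4) + (v 1 * w 3 + w 1 * v 3))]

lemma hasDerivAt_line_apply (x v : Fin 6 → ℝ) (i : Fin 6) :
    HasDerivAt (fun t : ℝ => (x + t • v) i) (v i) 0 := by
  simpa using ((hasDerivAt_id (0 : ℝ)).mul_const (v i)).const_add (x i)

lemma hasDerivAt_q4_line {x : Fin 6 → ℝ} (hx : 0 < 1 - x 3 ^ 2 - x 4 ^ 2 - x 5 ^ 2)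
    (v : Fin 6 → ℝ) : HasDerivAt (fun t : ℝ => q4 (x + t • v)) (dq4 x v) 0 := by
  have h := hasDerivAt_line_apply x v
  have hp := ((((h 3).fun_pow 2).const_sub 1).fun_sub ((h 4).fun_pow 2)).fun_sub ((h 5).fun_pow 2)
  refine (hp.sqrt (by simpa using hx.ne')).congr_deriv ?_
  have hs := Real.sqrt_pos.2 hx
  simp only [zero_smul, add_zero, dq4, q4]
  field_simp
  ring

lemma hasDerivAt_f0_line (I1 I2 I3 om : ℝ) {x : Fin 6 → ℝ}
    (hx : 0 < 1 - x 3 ^ 2 - x 4 ^ 2 - x 5 ^ 2) (v : Fin 6 → ℝ) :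
    HasDerivAt (fun t : ℝ => f0 I1 I2 I3 om (x + t • v)) (df0 I1 I2 I3 om x v) 0 := by
  have h := hasDerivAt_line_apply x v
  have hq := hasDerivAt_q4_line hx v
  rw [hasDerivAt_pi]
  intro i
  fin_cases i <;> simp [f0, df0, -Pi.add_apply, -Pi.smul_apply] <;>
  · eapply HasDerivAt.congr_deriv
    · repeat' first
        | exact hasDerivAt_const _ _
        | exact h _
        | exact hq
        | apply HasDerivAt.fun_add
        | apply HasDerivAt.fun_sub
        | apply HasDerivAt.fun_pow
        | apply HasDerivAt.fun_mul
        | apply HasDerivAt.fun_neg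
    · simp only [zero_smul, add_zero, Nat.cast_ofNat]
      ring

lemma q4_xe (om : ℝ) : q4 (xe om) = 1 := by simp [q4, xe]

lemma hasDerivAt_dq4_line_xe (om : ℝ) (v w : Fin 6 → ℝ) :
    HasDerivAt (fun t : ℝ => dq4 (xe om + t • v) w) (-(v 3 * w 3 + v 4 * w 4 + v 5 * w 5)) 0 := by
  have h := hasDerivAt_line_apply (xe om) v
  have hq := hasDerivAt_q4_line (x := xe om) (by simp [xe]) v
  have hn := ((((h 3).mul_const (w 3)).fun_add ((h 4).mul_const (w 4))).fun_add
    ((h 5).mul_const (w 5))).fun_neg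
  refine (hn.fun_div hq (by simp [q4_xe])).congr_deriv ?_
  simp only [zero_smul, add_zero, q4_xe]
  simp [xe]

lemma hasDerivAt_df0_line_xe (I1 I2 I3 om : ℝ) (v w : Fin 6 → ℝ) :
    HasDerivAt (fun t : ℝ => df0 I1 I2 I3 om (xe om + t • v) w) (d2f0 I1 I2 I3 om v w) 0 := by
  have h := hasDerivAt_line_apply (xe om) v
  have hq := hasDerivAt_q4_line (x := xe om) (by simp [xe]) v
  have hd := hasDerivAt_dq4_line_xe om v w
  have hv : dq4 (xe om) v = 0 := by simp [dq4, xe]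
  have hw : dq4 (xe om) w = 0 := by simp [dq4, xe]
  rw [hasDerivAt_pi]
  intro i
  fin_cases i <;> simp [d2f0, df0, -Pi.add_apply, -Pi.smul_apply] <;>
  · eapply HasDerivAt.congr_deriv
    · repeat' first
        | exact hasDerivAt_const _ _
        | exact h _
        | exact hq
        | exact hd
        | apply HasDerivAt.fun_add
        | apply HasDerivAt.fun_sub
        | apply HasDerivAt.fun_pow
        | apply HasDerivAt.fun_mul
        | apply HasDerivAt.fun_neg
    · simp only [zero_smul, add_zero, q4_xe, hv, hw]
      simp [xe]
      try ring

lemma contDiffAt_q4 {x : Fin 6 → ℝ} (hx : 0 < 1 - x 3 ^ 2 - x 4 ^ 2 - x 5 ^ 2) :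
    ContDiffAt ℝ ∞ q4 x :=
  ContDiffAt.sqrt (by fun_prop) hx.ne'

lemma contDiffAt_f0 (I1 I2 I3 om : ℝ) {x : Fin 6 → ℝ}
    (hx : 0 < 1 - x 3 ^ 2 - x 4 ^ 2 - x 5 ^ 2) : ContDiffAt ℝ ∞ (f0 I1 I2 I3 om) x := by
  have hq := contDiffAt_q4 hx
  rw [contDiffAt_pi]
  intro i
  fin_cases i <;> simp [f0] <;> fun_prop

lemma contDiffAt_f3 (I1 I2 b : ℝ) {x : Fin 6 → ℝ}
    (hx : 0 < 1 - x 3 ^ 2 - x 4 ^ 2 - x 5 ^ 2) : ContDiffAt ℝ ∞ (f3 I1 I2 b) x := by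
  have hq := contDiffAt_q4 hx
  rw [contDiffAt_pi]
  intro i
  fin_cases i <;> simp [f3] <;> fun_prop

lemma fderiv_eq_of_hasDerivAt_line {E F : Type*} [NormedAddCommGroup E] [NormedSpace ℝ E]
    [NormedAddCommGroup F] [NormedSpace ℝ F] {f : E → F} {x v : E} {f' : F}
    (hf : DifferentiableAt ℝ f x) (h : HasDerivAt (fun t : ℝ => f (x + t • v)) f' 0) :
    fderiv ℝ f x v = f' :=
  hf.lineDeriv_eq_fderiv.symm.trans (HasLineDerivAt.lineDeriv h)

lemma fderiv_f0 (I1 I2 I3 om : ℝ) {x : Fin 6 → ℝ}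
    (hx : 0 < 1 - x 3 ^ 2 - x 4 ^ 2 - x 5 ^ 2) (v : Fin 6 → ℝ) :
    fderiv ℝ (f0 I1 I2 I3 om) x v = df0 I1 I2 I3 om x v :=
  fderiv_eq_of_hasDerivAt_line ((contDiffAt_f0 I1 I2 I3 om hx).differentiableAt (by simp))
    (hasDerivAt_f0_line I1 I2 I3 om hx v)

lemma fderiv_fderiv_f0_xe (I1 I2 I3 om : ℝ) (v w : Fin 6 → ℝ) :
    fderiv ℝ (fderiv ℝ (f0 I1 I2 I3 om)) (xe om) v w = d2f0 I1 I2 I3 om v w := by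
  have hx : 0 < 1 - xe om 3 ^ 2 - xe om 4 ^ 2 - xe om 5 ^ 2 := by simp [xe]
  have hd : DifferentiableAt ℝ (fderiv ℝ (f0 I1 I2 I3 om)) (xe om) :=
    ((contDiffAt_f0 I1 I2 I3 om hx).fderiv_right (m := ∞) (by simp)).differentiableAt (by simp)
  have hw : fderiv ℝ (fun y => fderiv ℝ (f0 I1 I2 I3 om) y w) (xe om) v
      = fderiv ℝ (fderiv ℝ (f0 I1 I2 I3 om)) (xe om) v w := by
    rw [fderiv_clm_apply hd (differentiableAt_const w)]
    simp
  rw [← hw]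
  refine fderiv_eq_of_hasDerivAt_line (hd.clm_apply (differentiableAt_const w))
    ((hasDerivAt_df0_line_xe I1 I2 I3 om v w).congr_of_eventuallyEq ?_)
  have hc : Continuous fun t : ℝ => 1 - (xe om + t • v) 3 ^ 2 - (xe om + t • v) 4 ^ 2
      - (xe om + t • v) 5 ^ 2 := by
    simp only [Pi.add_apply, Pi.smul_apply]
    fun_prop
  filter_upwards [(hc.tendsto 0).eventually_const_lt (u := 0) (by simp [xe])] with t ht
  exact fderiv_f0 I1 I2 I3 om ht w

lemma fderiv_f3_xe (I1 I2 b om : ℝ) (v : Fin 6 → ℝ) :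
    fderiv ℝ (f3 I1 I2 b) (xe om) v = ![2 * b * v 5 / I1, 0, 0, 0, 0, 0] := by
  have hx : 0 < 1 - xe om 3 ^ 2 - xe om 4 ^ 2 - xe om 5 ^ 2 := by simp [xe]
  refine fderiv_eq_of_hasDerivAt_line ((contDiffAt_f3 I1 I2 b hx).differentiableAt (by simp)) ?_
  have h := hasDerivAt_line_apply (xe om) v
  have hq := hasDerivAt_q4_line hx v
  rw [hasDerivAt_pi]
  intro i
  fin_cases i
  · refine (((((h 5).fun_mul hq).fun_sub ((h 3).fun_mul (h 4))).const_mul (2 * b)).div_const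
      I1).congr_deriv ?_
    simp only [zero_smul, add_zero, q4_xe]
    simp [xe]
  · refine ((((((h 4).fun_pow 2).const_mul 2).const_sub 1).fun_sub
      (((h 5).fun_pow 2).const_mul 2)).const_mul b |>.div_const I2).congr_deriv ?_
    simp [xe]
  all_goals exact hasDerivAt_const _ _

section LieBracket

variable {f g : (Fin 6 → ℝ) → (Fin 6 → ℝ)} {x : Fin 6 → ℝ}

lemma ContDiffAt.lieB (hf : ContDiffAt ℝ ∞ f x) (hg : ContDiffAt ℝ ∞ g x) :
    ContDiffAt ℝ ∞ (lieB f g) x :=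
  ((hg.fderiv_right (m := ∞) (by simp)).clm_apply hf).sub
    ((hf.fderiv_right (m := ∞) (by simp)).clm_apply hg)

lemma lieB_of_eq_zero (h0 : f x = 0) : lieB f g x = -fderiv ℝ f x (g x) := by
  simp [lieB, h0]

lemma fderiv_lieB_of_eq_zero (hf : ContDiffAt ℝ ∞ f x) (hg : ContDiffAt ℝ ∞ g x)
    (h0 : f x = 0) (v : Fin 6 → ℝ) :
    fderiv ℝ (lieB f g) x v = fderiv ℝ g x (fderiv ℝ f x v)
      - fderiv ℝ (fderiv ℝ f) x v (g x) - fderiv ℝ f x (fderiv ℝ g x v) := by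
  have hf' : DifferentiableAt ℝ (fderiv ℝ f) x :=
    (hf.fderiv_right (m := ∞) (by simp)).differentiableAt (by simp)
  have hg' : DifferentiableAt ℝ (fderiv ℝ g) x :=
    (hg.fderiv_right (m := ∞) (by simp)).differentiableAt (by simp)
  have hfd := hf.differentiableAt (by simp)
  have hgd := hg.differentiableAt (by simp)
  have h := (hg'.hasFDerivAt.clm_apply hfd.hasFDerivAt).fun_sub
    (hf'.hasFDerivAt.clm_apply hgd.hasFDerivAt)
  have h2 : fderiv ℝ (lieB f g) x = _ := h.fderiv
  rw [h2]
  simp [h0]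
  abel

end LieBracket

lemma f0_xe (I1 I2 I3 om : ℝ) : f0 I1 I2 I3 om (xe om) = 0 := by
  ext i
  fin_cases i <;> simp [f0, xe]

lemma f3_xe (I1 I2 b om : ℝ) : f3 I1 I2 b (xe om) = ![0, b / I2, 0, 0, 0, 0] := by
  ext i
  fin_cases i <;> simp [f3, xe]

lemma df0_xe (I1 I2 I3 om : ℝ) (v : Fin 6 → ℝ) :
    df0 I1 I2 I3 om (xe om) v =
      ![-(6 * om ^ 2 * (I2 - I3) / I1 * v 3),
        (I3 - I1) / I2 * (-om * v 2) + 6 * om ^ 2 * (I3 - I1) / I2 * v 4,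
        (I1 - I2) / I3 * (-om * v 1),
        1 / 2 * v 0, 1 / 2 * v 1 - om * v 5, 1 / 2 * v 2 + om * v 4] := by
  have hv : dq4 (xe om) v = 0 := by simp [dq4, xe]
  ext i
  fin_cases i <;> (simp [df0, q4_xe, hv]; simp [xe]; try ring)

/-- h2 = [f3, [f0, [f0, [f0, f3]]]] evaluated at x_e. -/
theorem bracket_h2_at_equilibrium (I1 I2 I3 om b : ℝ)
    (hI1 : 0 < I1) (hI2 : 0 < I2) (hI3 : 0 < I3) (hom : om ≠ 0) (hb : b ≠ 0) :
    lieB (f3 I1 I2 b)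
        (lieB (f0 I1 I2 I3 om) (lieB (f0 I1 I2 I3 om) (lieB (f0 I1 I2 I3 om) (f3 I1 I2 b)))) (xe om)
      = ![0, 0, 0,
          -(om * b ^ 2 * (I1 ^ 2 - (2 * I2 + I3) * I1 + I2 * (I2 + 2 * I3)) / (I1 * I2 ^ 2 * I3)),
          0, 0] := by
  have hx : 0 < 1 - xe om 3 ^ 2 - xe om 4 ^ 2 - xe om 5 ^ 2 := by simp [xe]
  have hf := contDiffAt_f0 I1 I2 I3 om hx
  have h0 := f0_xe I1 I2 I3 om
  have hg := contDiffAt_f3 I1 I2 b hx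
  have hg1 := hf.lieB hg
  have hg2 := hf.lieB hg1
  rw [lieB, f3_xe, fderiv_f3_xe, fderiv_lieB_of_eq_zero hf hg2 h0,
    fderiv_lieB_of_eq_zero hf hg1 h0, fderiv_lieB_of_eq_zero hf hg1 h0]
  simp only [fderiv_lieB_of_eq_zero hf hg h0, lieB_of_eq_zero h0, fderiv_f0 I1 I2 I3 om hx,
    fderiv_fderiv_f0_xe, fderiv_f3_xe, f3_xe, df0_xe]
  have h1 := hI1.ne'
  have h2 := hI2.ne'
  have h3 := hI3.ne'
  ext i
  fin_cases i <;> simp [d2f0]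
  field_simp
  ring
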